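/- Let γ ≥ 0 and let Q be a self-adjoint Hilbert–Schmidt operator on H with all eigenvalues ≥ −γ. For λ > 0 with 4λγ < 1 (λ arbitrary if γ = 0), there exists a unique self-adjoint Hilbert–Schmidt operator P with all eigenvalues ≥ −2γ/(1 + √(1 − 4λγ)) such that λP² + P = Q; moreover ‖P‖_HS ≤ 2‖Q‖_HS/(1 + √(1 − 4λγ)). -/

import Mathlib

open scoped RealInnerProductSpace

section QuadraticFixedPoint

variable {R : Type*} [NormedRing R]

theorem norm_mul_self_sub_mul_self_le {r : ℝ} {Y Z : R} (hY : ‖Y‖ ≤ r) (hZ : ‖Z‖ ≤ r) :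
    ‖Y * Y - Z * Z‖ ≤ 2 * r * ‖Y - Z‖ := by
  have h : Y * Y - Z * Z = Y * (Y - Z) + (Y - Z) * Z := by noncomm_ring
  rw [h]
  refine (norm_add_le _ _).trans ?_
  have h1 : ‖Y * (Y - Z)‖ ≤ r * ‖Y - Z‖ := (norm_mul_le _ _).trans (by gcongr)
  have h2 : ‖(Y - Z) * Z‖ ≤ ‖Y - Z‖ * r := (norm_mul_le _ _).trans (by gcongr)
  linarith

variable [NormedAlgebra ℝ R]

theorem eq_of_two_smul_eq_add_mul_self {r : ℝ} (hr : r < 1) {K Y Z : R}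
    (hY : ‖Y‖ ≤ r) (hZ : ‖Z‖ ≤ r) (hYK : (2 : ℝ) • Y = K + Y * Y)
    (hZK : (2 : ℝ) • Z = K + Z * Z) : Y = Z := by
  have h : (2 : ℝ) • (Y - Z) = Y * Y - Z * Z := by
    rw [smul_sub, hYK, hZK]; abel
  have hn : 2 * ‖Y - Z‖ ≤ 2 * r * ‖Y - Z‖ := by
    have := norm_mul_self_sub_mul_self_le hY hZ
    rwa [← h, norm_smul, Real.norm_ofNat] at this
  have : ‖Y - Z‖ = 0 := by nlinarith [norm_nonneg (Y - Z)]
  exact sub_eq_zero.mp (norm_eq_zero.mp this)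

theorem exists_two_smul_eq_add_mul_self [CompleteSpace R] {r : ℝ} (hr0 : 0 ≤ r) (hr : r < 1)
    {K : R} (hK : ‖K‖ ≤ 2 * r - r ^ 2) :
    ∃ Y : R, ‖Y‖ ≤ r ∧ (2 : ℝ) • Y = K + Y * Y := by
  let f : R → R := fun Y => (2⁻¹ : ℝ) • (K + Y * Y)
  let s : Set R := Metric.closedBall 0 r
  have hs : Set.MapsTo f s s := by
    intro Y hY
    rw [mem_closedBall_zero_iff] at hY ⊢
    have h1 : ‖Y * Y‖ ≤ r * r := (norm_mul_le _ _).trans (by gcongr)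
    have h2 := norm_add_le K (Y * Y)
    rw [norm_smul, norm_inv, Real.norm_ofNat]
    linarith
  have hf : ContractingWith ⟨r, hr0⟩ (hs.restrict f s s) := by
    refine ⟨by exact_mod_cast hr, LipschitzWith.of_dist_le_mul fun Y Z => ?_⟩
    have h := norm_mul_self_sub_mul_self_le (mem_closedBall_zero_iff.mp Y.2)
      (mem_closedBall_zero_iff.mp Z.2)
    have hd : f Y - f Z = (2⁻¹ : ℝ) • ((Y : R) * Y - Z * Z) := by
      rw [← smul_sub]; congr 1; abel
    rw [Subtype.dist_eq, Subtype.dist_eq, dist_eq_norm, dist_eq_norm]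
    change ‖f Y - f Z‖ ≤ r * ‖(Y : R) - Z‖
    rw [hd, norm_smul, norm_inv, Real.norm_ofNat]
    linarith
  obtain ⟨Y, hY, hfix, -⟩ := hf.exists_fixedPoint' Metric.isClosed_closedBall.isComplete hs
    (Metric.mem_closedBall_self hr0) (edist_ne_top _ _)
  refine ⟨Y, mem_closedBall_zero_iff.mp hY, ?_⟩
  nth_rewrite 1 [← hfix.eq]
  rw [smul_inv_smul₀ two_ne_zero]

end QuadraticFixedPoint

section SquareRoot

variable {H : Type*} [NormedAddCommGroup H] [InnerProductSpace ℝ H]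

theorem ContinuousLinearMap.norm_le_of_abs_inner_le {T : H →L[ℝ] H}
    (hT : ∀ u v : H, ⟪T u, v⟫ = ⟪u, T v⟫) {c : ℝ} (hc : 0 ≤ c)
    (h : ∀ u : H, |⟪T u, u⟫| ≤ c * ‖u‖ ^ 2) : ‖T‖ ≤ c := by
  rw [T.norm_eq_iSup_rayleighQuotient hT]
  refine ciSup_le fun x => ?_
  rw [ContinuousLinearMap.rayleighQuotient, ContinuousLinearMap.reApplyInnerSelf_apply, abs_div,
    abs_sq]
  exact div_le_of_le_mul₀ (sq_nonneg _) hc (h x)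

theorem two_smul_one_sub_eq_iff {R : Type*} [Ring R] [Algebra ℝ R] {m : ℝ} (hm : m ≠ 0)
    {A S : R} :
    (2 : ℝ) • (1 - m⁻¹ • S) = (1 - (m ^ 2)⁻¹ • A) + (1 - m⁻¹ • S) * (1 - m⁻¹ • S) ↔
      S * S = A := by
  have h : (1 - (m ^ 2)⁻¹ • A) + (1 - m⁻¹ • S) * (1 - m⁻¹ • S) - (2 : ℝ) • (1 - m⁻¹ • S) =
      (m ^ 2)⁻¹ • (S * S - A) := by
    simp only [mul_sub, sub_mul, mul_one, one_mul, smul_mul_assoc, mul_smul_comm, smul_smul,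
      smul_sub, sq, mul_inv]
    module
  rw [eq_comm, ← sub_eq_zero, h, smul_eq_zero_iff_right (by positivity), sub_eq_zero]

variable {s m : ℝ} {A : H →L[ℝ] H}

theorem norm_one_sub_inv_smul_le_of_mul_self_eq (hs : 0 < s) (hsm : s ≤ m)
    (hAm : ∀ u : H, ⟪A u, u⟫ ≤ m ^ 2 * ‖u‖ ^ 2) {S : H →L[ℝ] H}
    (hS : ∀ u v : H, ⟪S u, v⟫ = ⟪u, S v⟫) (hSs : ∀ u : H, s * ‖u‖ ^ 2 ≤ ⟪S u, u⟫)
    (hSA : S * S = A) : ‖1 - m⁻¹ • S‖ ≤ 1 - m⁻¹ * s := by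
  have hm : 0 < m := hs.trans_le hsm
  have hms : m⁻¹ * s ≤ 1 := by rw [inv_mul_le_one₀ hm]; exact hsm
  refine ContinuousLinearMap.norm_le_of_abs_inner_le (fun u v => ?_) (by linarith) fun u => ?_
  · simp [inner_sub_left, inner_sub_right, inner_smul_left, inner_smul_right, hS]
  · have hSu : ‖S u‖ ≤ m * ‖u‖ := by
      have h := hAm u
      rw [← hSA, mul_apply_eq_comp, hS, real_inner_self_eq_norm_sq, ← mul_pow] at h
      exact le_of_sq_le_sq h (by positivity)
    have hupper : ⟪S u, u⟫ ≤ m * ‖u‖ ^ 2 := by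
      nlinarith [real_inner_le_norm (S u) u, norm_nonneg u]
    have hq : ⟪(1 - m⁻¹ • S) u, u⟫ = ‖u‖ ^ 2 - m⁻¹ * ⟪S u, u⟫ := by
      simp [inner_sub_left, inner_smul_left]
    have h1 := mul_le_mul_of_nonneg_left hupper (inv_nonneg.mpr hm.le)
    have h2 := mul_le_mul_of_nonneg_left (hSs u) (inv_nonneg.mpr hm.le)
    rw [inv_mul_cancel_left₀ hm.ne'] at h1
    rw [hq, abs_of_nonneg (by linarith)]
    linarith

/-- A symmetric operator with `s² ≤ A ≤ m²` has exactly one symmetric square root `S ≥ s`. -/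
theorem existsUnique_mul_self_eq [CompleteSpace H] (hs : 0 < s) (hsm : s ≤ m)
    (hA : ∀ u v : H, ⟪A u, v⟫ = ⟪u, A v⟫) (hAs : ∀ u : H, s ^ 2 * ‖u‖ ^ 2 ≤ ⟪A u, u⟫)
    (hAm : ∀ u : H, ⟪A u, u⟫ ≤ m ^ 2 * ‖u‖ ^ 2) :
    ∃! S : H →L[ℝ] H, (∀ u v : H, ⟪S u, v⟫ = ⟪u, S v⟫) ∧
      (∀ u : H, s * ‖u‖ ^ 2 ≤ ⟪S u, u⟫) ∧ S * S = A := by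
  have hm : 0 < m := hs.trans_le hsm
  have hms : m⁻¹ * s ≤ 1 := by rw [inv_mul_le_one₀ hm]; exact hsm
  have hms0 : 0 < m⁻¹ * s := by positivity
  set r : ℝ := 1 - m⁻¹ * s with hr
  set K : H →L[ℝ] H := 1 - (m ^ 2)⁻¹ • A with hK
  have hKsymm : ∀ u v : H, ⟪K u, v⟫ = ⟪u, K v⟫ := fun u v => by
    simp [hK, inner_sub_left, inner_sub_right, inner_smul_left, inner_smul_right, hA]
  have hKr : ‖K‖ ≤ 2 * r - r ^ 2 := by
    refine ContinuousLinearMap.norm_le_of_abs_inner_le hKsymm (by nlinarith) fun u => ?_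
    have hq : ⟪K u, u⟫ = ‖u‖ ^ 2 - (m ^ 2)⁻¹ * ⟪A u, u⟫ := by
      simp [hK, inner_sub_left, inner_smul_left]
    have h1 := mul_le_mul_of_nonneg_left (hAm u) (inv_nonneg.mpr (sq_nonneg m))
    have h2 := mul_le_mul_of_nonneg_left (hAs u) (inv_nonneg.mpr (sq_nonneg m))
    rw [inv_mul_cancel_left₀ (by positivity)] at h1
    have h3 : 2 * r - r ^ 2 = 1 - (m ^ 2)⁻¹ * s ^ 2 := by rw [hr, ← inv_pow]; ring
    rw [hq, h3, abs_of_nonneg (by linarith)]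
    linarith
  obtain ⟨Y, hYr, hYK⟩ := exists_two_smul_eq_add_mul_self (by linarith) (by linarith) hKr
  have hYadj : ContinuousLinearMap.adjoint Y = Y := by
    have hKadj : ContinuousLinearMap.adjoint K = K :=
      (ContinuousLinearMap.isSelfAdjoint_iff_isSymmetric.mpr hKsymm).adjoint_eq
    refine eq_of_two_smul_eq_add_mul_self (by linarith)
      ((LinearIsometryEquiv.norm_map _ Y).trans_le hYr) hYr ?_ hYK
    have h := congrArg ContinuousLinearMap.adjoint hYK
    rw [map_add, hKadj, ContinuousLinearMap.mul_def, ContinuousLinearMap.adjoint_comp] at h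
    rw [ContinuousLinearMap.mul_def, ← h]
    simp
  have hYsymm : ∀ u v : H, ⟪Y u, v⟫ = ⟪u, Y v⟫ := fun u v => by
    conv_lhs => rw [← hYadj, ContinuousLinearMap.adjoint_inner_left]
  have hYS : 1 - m⁻¹ • (m • (1 - Y)) = Y := by
    rw [inv_smul_smul₀ hm.ne']; abel
  refine ⟨m • (1 - Y), ⟨fun u v => ?_, fun u => ?_, ?_⟩, ?_⟩
  · simp [inner_sub_left, inner_sub_right, inner_smul_left, inner_smul_right, hYsymm]
  · have hq : ⟪(m • (1 - Y)) u, u⟫ = m * (‖u‖ ^ 2 - ⟪Y u, u⟫) := by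
      simp [inner_sub_left, inner_smul_left]
    have h1 : ⟪Y u, u⟫ ≤ r * ‖u‖ ^ 2 := by
      have h2 := Y.le_of_opNorm_le hYr u
      nlinarith [real_inner_le_norm (Y u) u, norm_nonneg u]
    have h3 : s = m * (1 - r) := by rw [hr]; field_simp; ring
    rw [hq, h3]
    nlinarith
  · rw [← two_smul_one_sub_eq_iff hm.ne', hYS, hYK]
  · rintro S ⟨hS, hSs, hSA⟩
    have h : 1 - m⁻¹ • S = Y := eq_of_two_smul_eq_add_mul_self (by linarith)
      (norm_one_sub_inv_smul_le_of_mul_self_eq hs hsm hAm hS hSs hSA) hYr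
      ((two_smul_one_sub_eq_iff hm.ne').mpr hSA) hYK
    rw [← h, sub_sub_cancel, smul_inv_smul₀ hm.ne']

end SquareRoot

theorem one_add_two_smul_mul_self {R : Type*} [Ring R] [Algebra ℝ R] {l : ℝ} (hl : l ≠ 0)
    {P Q : R} :
    (1 + (2 * l) • P) * (1 + (2 * l) • P) = 1 + (4 * l) • Q ↔ l • (P * P) + P = Q := by
  have h : (1 + (2 * l) • P) * (1 + (2 * l) • P) - (1 + (4 * l) • Q) =
      (4 * l) • (l • (P * P) + P - Q) := by
    simp only [mul_add, add_mul, mul_one, one_mul, smul_mul_assoc, mul_smul_comm]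
    module
  rw [← sub_eq_zero, h, smul_eq_zero_iff_right (by positivity), sub_eq_zero]

theorem norm_apply_le_of_smul_comp_self_add {H : Type*} [NormedAddCommGroup H]
    [InnerProductSpace ℝ H] {l s c : ℝ} (hl : 0 < l) (hs : 0 < s) (hc : 2 * l * c = 1 - s)
    {P Q : H →L[ℝ] H} (hP : ∀ u : H, -c * ‖u‖ ^ 2 ≤ ⟪P u, u⟫)
    (hPQ : l • (P.comp P) + P = Q) (u : H) : ‖P u‖ ≤ 2 / (1 + s) * ‖Q u‖ := by
  have hq : ⟪Q u, P u⟫ = l * ⟪P (P u), P u⟫ + ‖P u‖ ^ 2 := by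
    simp [← hPQ, inner_add_left, inner_smul_left]
  have h1 := mul_le_mul_of_nonneg_left (hP (P u)) hl.le
  have h2 : (1 + s) * ‖P u‖ ^ 2 ≤ 2 * ‖Q u‖ * ‖P u‖ := by
    have h3 : 2 * (l * (-c * ‖P u‖ ^ 2)) = (s - 1) * ‖P u‖ ^ 2 := by
      linear_combination (-‖P u‖ ^ 2) * hc
    linarith [real_inner_le_norm (Q u) (P u)]
  rw [div_mul_eq_mul_div, le_div_iff₀ (by positivity)]
  rcases (norm_nonneg (P u)).eq_or_lt with h | h
  · rw [← h, zero_mul]; positivity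
  · exact le_of_mul_le_mul_right (by linarith) h

/-- Solvability of `λP² + P = Q` for self-adjoint Hilbert–Schmidt `Q` with eigenvalues
`≥ -γ` (quadratic-form sense): for `λ > 0` with `4λγ < 1` there is a unique
self-adjoint Hilbert–Schmidt `P` with eigenvalues `≥ -2γ/(1 + √(1-4λγ))` solving the
equation, and `‖P‖_HS ≤ 2‖Q‖_HS/(1 + √(1-4λγ))`. -/
theorem stmt_11 {H : Type*} [NormedAddCommGroup H] [InnerProductSpace ℝ H] [CompleteSpace H]
    (b : HilbertBasis ℕ ℝ H)
    (γ l : ℝ) (hγ : 0 ≤ γ) (hl : 0 < l) (hlγ : 4 * l * γ < 1)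
    (Q : H →L[ℝ] H)
    (hQsa : ∀ u v : H, ⟪Q u, v⟫ = ⟪u, Q v⟫)
    (hQsum : Summable fun n => ‖Q (b n)‖ ^ 2)
    (hQγ : ∀ u : H, -γ * ‖u‖ ^ 2 ≤ ⟪Q u, u⟫) :
    ∃ P : H →L[ℝ] H,
      ((∀ u v : H, ⟪P u, v⟫ = ⟪u, P v⟫) ∧
          (Summable fun n => ‖P (b n)‖ ^ 2) ∧
          (∀ u : H, -(2 * γ) / (1 + Real.sqrt (1 - 4 * l * γ)) * ‖u‖ ^ 2 ≤ ⟪P u, u⟫) ∧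
          l • (P.comp P) + P = Q) ∧
        Real.sqrt (∑' n, ‖P (b n)‖ ^ 2) ≤
          2 * Real.sqrt (∑' n, ‖Q (b n)‖ ^ 2) / (1 + Real.sqrt (1 - 4 * l * γ)) ∧
        ∀ P' : H →L[ℝ] H,
          ((∀ u v : H, ⟪P' u, v⟫ = ⟪u, P' v⟫) ∧
            (Summable fun n => ‖P' (b n)‖ ^ 2) ∧
            (∀ u : H, -(2 * γ) / (1 + Real.sqrt (1 - 4 * l * γ)) * ‖u‖ ^ 2 ≤ ⟪P' u, u⟫) ∧
            l • (P'.comp P') + P' = Q) → P' = P := by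
  set s := Real.sqrt (1 - 4 * l * γ)
  have hs : 0 < s := Real.sqrt_pos.mpr (by linarith)
  have hs2 : s ^ 2 = 1 - 4 * l * γ := Real.sq_sqrt (by linarith)
  have hs1 : s ≤ 1 := by nlinarith [mul_nonneg hl.le hγ]
  have hc : 2 * l * (2 * γ / (1 + s)) = 1 - s := by
    field_simp
    linear_combination hs2
  simp only [neg_div]
  set c := 2 * γ / (1 + s)
  have hbound : ∀ P : H →L[ℝ] H, (∀ u : H, -c * ‖u‖ ^ 2 ≤ ⟪P u, u⟫) ↔
      ∀ u : H, s * ‖u‖ ^ 2 ≤ ⟪(1 + (2 * l) • P) u, u⟫ := fun P => by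
    refine forall_congr' fun u => ?_
    have hq : ⟪(1 + (2 * l) • P) u, u⟫ = ‖u‖ ^ 2 + 2 * l * ⟪P u, u⟫ := by
      simp [inner_add_left, inner_smul_left]
    have h : s * ‖u‖ ^ 2 = ‖u‖ ^ 2 + 2 * l * (-c * ‖u‖ ^ 2) := by
      linear_combination ‖u‖ ^ 2 * hc
    rw [hq, h, add_le_add_iff_left, mul_le_mul_iff_right₀ (by positivity)]
  have hsymm : ∀ (t : ℝ) (P : H →L[ℝ] H), (∀ u v : H, ⟪P u, v⟫ = ⟪u, P v⟫) →
      ∀ u v : H, ⟪(1 + t • P) u, v⟫ = ⟪u, (1 + t • P) v⟫ := fun t P hP u v => by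
    simp [inner_add_left, inner_add_right, inner_smul_left, inner_smul_right, hP]
  have hAq : ∀ u : H, ⟪(1 + (4 * l) • Q) u, u⟫ = ‖u‖ ^ 2 + 4 * l * ⟪Q u, u⟫ := fun u => by
    simp [inner_add_left, inner_smul_left]
  have hm1 : 1 ≤ 1 + 4 * l * ‖Q‖ := le_add_of_nonneg_right (by positivity)
  obtain ⟨S, ⟨hS, hSs, hSA⟩, huniq⟩ := existsUnique_mul_self_eq (A := 1 + (4 * l) • Q)
    (m := 1 + 4 * l * ‖Q‖) hs (hs1.trans hm1) (hsymm _ Q hQsa)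
    (fun u => by
      rw [hAq, hs2]
      nlinarith [mul_le_mul_of_nonneg_left (hQγ u) hl.le])
    (fun u => by
      rw [hAq]
      have h1 : ⟪Q u, u⟫ ≤ ‖Q‖ * ‖u‖ ^ 2 := by
        nlinarith [real_inner_le_norm (Q u) u, Q.le_opNorm u, norm_nonneg u]
      have h2 := mul_le_mul_of_nonneg_left h1 hl.le
      have h3 := mul_le_mul_of_nonneg_right (le_self_pow₀ hm1 two_ne_zero) (sq_nonneg ‖u‖)
      linarith)
  obtain ⟨P, rfl⟩ : ∃ P : H →L[ℝ] H, 1 + (2 * l) • P = S :=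
    ⟨(2 * l)⁻¹ • (S - 1), by rw [smul_inv_smul₀ (by positivity)]; abel⟩
  have hPQ : l • (P.comp P) + P = Q := (one_add_two_smul_mul_self hl.ne').mp hSA
  have hPc := (hbound P).mpr hSs
  have hPsq : ∀ n, ‖P (b n)‖ ^ 2 ≤ (2 / (1 + s)) ^ 2 * ‖Q (b n)‖ ^ 2 := fun n => by
    rw [← mul_pow]
    gcongr
    exact norm_apply_le_of_smul_comp_self_add hl hs hc hPc hPQ (b n)
  have hPsum : Summable fun n => ‖P (b n)‖ ^ 2 :=
    (hQsum.mul_left _).of_nonneg_of_le (fun _ => by positivity) hPsq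
  refine ⟨P, ⟨fun u v => ?_, hPsum, hPc, hPQ⟩, ?_, ?_⟩
  · have h := hS u v
    simpa [inner_add_left, inner_add_right, inner_smul_left, inner_smul_right, hl.ne'] using h
  · calc Real.sqrt (∑' n, ‖P (b n)‖ ^ 2)
        ≤ Real.sqrt ((2 / (1 + s)) ^ 2 * ∑' n, ‖Q (b n)‖ ^ 2) := by
          rw [← tsum_mul_left]
          exact Real.sqrt_le_sqrt (hPsum.tsum_le_tsum hPsq (hQsum.mul_left _))
      _ = 2 * Real.sqrt (∑' n, ‖Q (b n)‖ ^ 2) / (1 + s) := by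
          rw [Real.sqrt_mul (sq_nonneg _), Real.sqrt_sq (by positivity), div_mul_eq_mul_div]
  · rintro P' ⟨hP', -, hP'c, hP'Q⟩
    have h := huniq (1 + (2 * l) • P') ⟨hsymm _ P' hP', (hbound P').mp hP'c,
      (one_add_two_smul_mul_self hl.ne').mpr hP'Q⟩
    exact smul_right_injective _ (by positivity : 2 * l ≠ 0) (add_left_cancel h)
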